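/- Let u be a real number, v and w = conj(v) non-real complex conjugates. If real n×n matrices a, b, c are simultaneously diagonalizable over ℂ with each triple of diagonal entries a permutation of (u,v,w), then the kernel ker(a - u·I) (as a complex subspace of ℂⁿ) has even complex dimension. -/

import Mathlib

open Matrix in
/-- The kernel of a matrix conjugate to a diagonal one has dimension the number of zero entries. -/
lemma finrank_ker_toLin'_eq_card_of_conj_diagonal {n : ℕ} (M p : Matrix (Fin n) (Fin n) ℂ)
    (hp : IsUnit p.det) (d : Fin n → ℂ) (h : p⁻¹ * M * p = diagonal d) :
    Module.finrank ℂ (LinearMap.ker (Matrix.toLin' M)) =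
      (Finset.univ.filter fun i => d i = 0).card := by
  have hrank : M.rank = (Finset.univ.filter fun i => d i ≠ 0).card := by
    have h1 : (p⁻¹ * M * p).rank = M.rank := by
      rw [rank_mul_eq_left_of_isUnit_det p _ hp,
        rank_mul_eq_right_of_isUnit_det p⁻¹ _ (isUnit_nonsing_inv_det p hp)]
    rw [← h1, h, rank_diagonal, Fintype.card_subtype]
  have h2 := LinearMap.finrank_range_add_finrank_ker (Matrix.toLin' M)
  have h3 : M.rank = Module.finrank ℂ (LinearMap.range (Matrix.toLin' M)) := rfl
  have h4 := Finset.card_filter_add_card_filter_not (s := (Finset.univ : Finset (Fin n)))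
    (fun i => d i = 0)
  rw [Module.finrank_fin_fun] at h2
  rw [Finset.card_univ, Fintype.card_fin] at h4
  simp only [ne_eq] at hrank
  omega

/-- A finite set over which signed copies of a nonzero real number sum to zero has even size. -/
lemma even_card_of_sum_eq_zero_of_eq_or_eq_neg {ι : Type*} (s : Finset ι) (f : ι → ℝ) {r : ℝ}
    (hr : r ≠ 0) (hf : ∀ i ∈ s, f i = r ∨ f i = -r) (hsum : ∑ i ∈ s, f i = 0) :
    Even s.card := by
  classical
  have h1 : ∑ i ∈ s, f i = ∑ i ∈ s, if f i = r then r else -r := by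
    refine Finset.sum_congr rfl fun i hi => ?_
    split_ifs with h
    · exact h
    · exact (hf i hi).resolve_left h
  rw [h1, Finset.sum_ite, Finset.sum_const, Finset.sum_const, nsmul_eq_mul, nsmul_eq_mul] at hsum
  have h2 : ((s.filter fun i => f i = r).card : ℝ) = (s.filter fun i => ¬ f i = r).card :=
    mul_right_cancel₀ hr (by linarith)
  have h3 := Finset.card_filter_add_card_filter_not (s := s) (fun i => f i = r)
  rw [← h3, ← Nat.cast_injective h2]
  exact ⟨_, rfl⟩

open Matrix in
theorem stmt9 {n : ℕ} (u : ℝ) (v : ℂ) (hv : v.im ≠ 0)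
    (a b c : Matrix (Fin n) (Fin n) ℝ)
    (p : Matrix (Fin n) (Fin n) ℂ) (hp : IsUnit p.det)
    (A B C : Matrix (Fin n) (Fin n) ℂ)
    (hA : A = p⁻¹ * a.map (Complex.ofReal) * p)
    (hB : B = p⁻¹ * b.map (Complex.ofReal) * p)
    (hC : C = p⁻¹ * c.map (Complex.ofReal) * p)
    (hAd : A.IsDiag) (hBd : B.IsDiag) (hCd : C.IsDiag)
    (hperm : ∀ i : Fin n,
      ({A i i, B i i, C i i} : Multiset ℂ) =
        {(u : ℂ), v, (starRingEnd ℂ) v}) :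
    Even (Module.finrank ℂ
      (LinearMap.ker (Matrix.toLin' (a.map (Complex.ofReal) - (u : ℂ) • 1)))) := by
  have hA' : diagonal (fun i => A i i) = A := hAd.diagonal_diag
  have hB' : diagonal (fun i => B i i) = B := hBd.diagonal_diag
  have hpp : p * p⁻¹ = 1 := mul_nonsing_inv p hp
  have hpp' : p⁻¹ * p = 1 := nonsing_inv_mul p hp
  rw [finrank_ker_toLin'_eq_card_of_conj_diagonal _ p hp (fun i => A i i - u)]
  swap
  · rw [← diagonal_sub, hA', hA, mul_sub, sub_mul, mul_smul_comm, mul_one, smul_mul_assoc, hpp',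
      smul_one_eq_diagonal]
  have hcase (i : Fin n) : A i i = u ∧ (B i i = v ∨ B i i = starRingEnd ℂ v) ∨
      A i i = v ∨ A i i = starRingEnd ℂ v := by
    have h := hperm i
    have hmem : A i i ∈ ({(u : ℂ), v, (starRingEnd ℂ) v} : Multiset ℂ) := by rw [← h]; simp
    simp only [Multiset.insert_eq_cons, Multiset.mem_cons, Multiset.mem_singleton] at hmem
    rcases hmem with hu | hmem
    · refine .inl ⟨hu, ?_⟩
      rw [hu] at h
      simp only [Multiset.insert_eq_cons, Multiset.cons_inj_right] at h
      have hmem : B i i ∈ (v ::ₘ {(starRingEnd ℂ) v} : Multiset ℂ) := by rw [← h]; simp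
      simpa using hmem
    · exact .inr hmem
  let x : Matrix (Fin n) (Fin n) ℝ :=
    a * a * b - (2 * v.re) • (a * b) + Complex.normSq v • b
  let X : Matrix (Fin n) (Fin n) ℂ :=
    A * A * B - (2 * v.re : ℂ) • (A * B) + (Complex.normSq v : ℂ) • B
  have hconj (y z : Matrix (Fin n) (Fin n) ℂ) :
      p⁻¹ * y * p * (p⁻¹ * z * p) = p⁻¹ * (y * z) * p := by
    calc p⁻¹ * y * p * (p⁻¹ * z * p) = p⁻¹ * y * (p * p⁻¹) * z * p := by noncomm_ring
      _ = p⁻¹ * (y * z) * p := by rw [hpp]; noncomm_ring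
  have hmap (y z : Matrix (Fin n) (Fin n) ℝ) :
      (y * z).map Complex.ofReal = y.map Complex.ofReal * z.map Complex.ofReal :=
    Matrix.map_mul (f := Complex.ofRealHom)
  have hX : X = p⁻¹ * x.map Complex.ofReal * p := by
    have hx : x.map Complex.ofReal =
        (a * a * b).map Complex.ofReal - (2 * v.re : ℂ) • (a * b).map Complex.ofReal +
          (Complex.normSq v : ℂ) • b.map Complex.ofReal := by
      ext i j
      simp [x]
    simp only [X, hx, hmap, hA, hB, hconj, mul_add, mul_sub, add_mul, sub_mul, mul_smul_comm,
      smul_mul_assoc]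
  have htr : X.trace = (x.trace : ℂ) := by
    rw [hX, trace_mul_comm, ← mul_assoc, hpp, one_mul]
    simp [trace]
  have htr' : X.trace = ∑ i, (A i i - v) * (A i i - starRingEnd ℂ v) * B i i := by
    have hre : (2 * v.re : ℂ) = v + starRingEnd ℂ v := by
      rw [Complex.add_conj]; push_cast; ring
    have hd : X = diagonal fun i => (A i i - v) * (A i i - starRingEnd ℂ v) * B i i := by
      simp only [X]
      rw [← hA', ← hB', hre, ← Complex.mul_conj]
      simp only [diagonal_mul_diagonal, ← diagonal_smul, diagonal_sub, diagonal_add,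
        diagonal_apply_eq]
      congr 1
      ext i
      simp only [Pi.smul_apply, smul_eq_mul]
      ring
    rw [hd, trace_diagonal]
  have hsum : Complex.normSq (u - v) * ∑ i with A i i - u = 0, (B i i).im = 0 := by
    have h0 : X.trace.im = 0 := by rw [htr, Complex.ofReal_im]
    rw [← h0, htr', Complex.im_sum, Finset.mul_sum, Finset.sum_filter]
    refine Finset.sum_congr rfl fun i _ => ?_
    split_ifs with h
    · have hn : ((u : ℂ) - v) * (u - starRingEnd ℂ v) = (Complex.normSq (u - v) : ℂ) := by
        rw [← Complex.mul_conj, map_sub, Complex.conj_ofReal]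
      rw [sub_eq_zero.mp h, hn, Complex.im_ofReal_mul]
    · rcases hcase i with ⟨hu, -⟩ | h' | h'
      · exact absurd (sub_eq_zero.mpr hu) h
      · simp [h']
      · simp [h']
  have huv : Complex.normSq (u - v) ≠ 0 := by
    rw [Ne, Complex.normSq_eq_zero, sub_eq_zero]
    rintro rfl
    exact hv (Complex.ofReal_im u)
  refine even_card_of_sum_eq_zero_of_eq_or_eq_neg _ (fun i => (B i i).im) hv (fun i hi => ?_)
    ((mul_eq_zero.mp hsum).resolve_left huv)
  have hu : A i i = u := sub_eq_zero.mp (Finset.mem_filter.mp hi).2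
  rcases hcase i with ⟨-, h | h⟩ | h | h
  · exact .inl (by rw [h])
  · exact .inr (by rw [h, Complex.conj_im])
  · exact absurd (by rw [← h, hu, Complex.ofReal_im]) hv
  · refine absurd ?_ hv
    rw [← neg_eq_zero, ← Complex.conj_im, ← h, hu, Complex.ofReal_im]
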